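/- For every d ≥ 1 and every ε ∈ (0,1] there exists γ = γ(ε, d) ∈ (0,1] such that the following holds. Let B be an axis-parallel box in ℝ^d and let S be a finite set of m points in ℝ^d with m ≥ 3d. Suppose that for every two translated copies B', B'' of B, at least ε·m points of S lie outside B' ∪ B'' (i.e., no 2 translates of B cover more than (1-ε)·m points of S). Then at least a γ fraction of the 3d-element subsets of S cannot be covered by any 2 translated copies of B. -/

import Mathlib

/-- `B` is an axis-parallel box in `ℝ^d`. -/
def IsBox {d : ℕ} (B : Set (Fin d → ℝ)) : Prop :=
  ∃ a b : Fin d → ℝ, (∀ j, a j ≤ b j) ∧ B = Set.Icc a b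

open Finset in
/-- A set of parity constraints `σ a + α = σ b + β` on `d` variables that has no solution contains
`d` constraints that already have no common solution. -/
theorem exists_inconsistent_parity_subsystem {d : ℕ} (hd : 1 ≤ d)
    (H : Set ((Fin d × ZMod 2) × (Fin d × ZMod 2)))
    (hH : ∀ σ : Fin d → ZMod 2, ∃ κ ∈ H, σ κ.1.1 + κ.1.2 ≠ σ κ.2.1 + κ.2.2) :
    ∃ g : Fin d → (Fin d × ZMod 2) × (Fin d × ZMod 2), (∀ i, g i ∈ H) ∧
      ∀ σ : Fin d → ZMod 2,
        ∃ i, σ (g i).1.1 + (g i).1.2 ≠ σ (g i).2.1 + (g i).2.2 := by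
  classical
  obtain ⟨κ₀, hκ₀, -⟩ := hH 0
  let z : Fin d := ⟨0, hd⟩
  let e : Fin d → Fin d → ZMod 2 := fun a => if a = z then 0 else Pi.single a 1
  let vec : (Fin d × ZMod 2) × (Fin d × ZMod 2) → Fin d → ZMod 2 := fun κ =>
    e κ.1.1 + e κ.2.1 + Pi.single z (κ.1.2 + κ.2.2)
  let φ : (Fin d → ZMod 2) → (Fin d → ZMod 2) →ₗ[ZMod 2] ZMod 2 := fun σ =>
    Fintype.linearCombination (ZMod 2) fun j => if j = z then 1 else σ j + σ z
  have he : ∀ σ a, φ σ (e a) = σ a + σ z := by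
    intro σ a
    by_cases ha : a = z
    · simp [e, ha, CharTwo.add_self_eq_zero]
    · simp [e, φ, ha, Fintype.linearCombination_apply_single]
  have hφ : ∀ σ κ, φ σ (vec κ) = 0 ↔ σ κ.1.1 + κ.1.2 = σ κ.2.1 + κ.2.2 := by
    intro σ κ
    have h1 : φ σ (vec κ) = (σ κ.1.1 + σ z) + (σ κ.2.1 + σ z) + (κ.1.2 + κ.2.2) := by
      simp only [vec, map_add, he]
      simp [φ, Fintype.linearCombination_apply_single]
    rw [h1]
    generalize σ κ.1.1 = p
    generalize σ κ.2.1 = q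
    generalize σ z = r
    generalize κ.1.2 = s
    generalize κ.2.2 = t
    revert p q r s t
    decide
  obtain ⟨f, hf, hspan, -⟩ :=
    Submodule.exists_fun_fin_finrank_span_eq (ZMod 2) (vec '' H)
  choose k hkH hk using hf
  have hr : Module.finrank (ZMod 2) (Submodule.span (ZMod 2) (vec '' H)) ≤ d := by
    simpa using Submodule.finrank_le (Submodule.span (ZMod 2) (vec '' H))
  refine ⟨fun i => if h : i.1 < _ then k ⟨i.1, h⟩ else κ₀, fun i => ?_, fun σ => ?_⟩
  · dsimp only
    split_ifs with h
    exacts [hkH _, hκ₀]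
  · by_contra! hcon
    obtain ⟨κ, hκ, hne⟩ := hH σ
    refine hne ((hφ σ κ).1 ?_)
    have hle : Submodule.span (ZMod 2) (Set.range f) ≤ LinearMap.ker (φ σ) := by
      rw [Submodule.span_le]
      rintro _ ⟨i, rfl⟩
      have h := hcon ⟨i.1, i.2.trans_le hr⟩
      rw [dif_pos i.2] at h
      rw [SetLike.mem_coe, LinearMap.mem_ker, ← hk i]
      exact (hφ σ _).2 h
    rw [hspan] at hle
    exact hle (Submodule.subset_span ⟨κ, hκ, rfl⟩)

open Finset in
theorem exists_lower_quantile {α : Type*} (S : Finset α) (hS : S.Nonempty) (f : α → ℝ) {t : ℝ}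
    (ht₀ : 0 ≤ t) (ht : t ≤ #S) :
    ∃ l : ℝ, t ≤ #{x ∈ S | f x ≤ l} ∧ #{x ∈ S | f x < l} ≤ t := by
  classical
  obtain ⟨y, hyS, hy⟩ := S.exists_max_image f hS
  have hne : {x ∈ S | t ≤ #{z ∈ S | f z ≤ f x}}.Nonempty :=
    ⟨y, mem_filter.2 ⟨hyS, by rwa [filter_true_of_mem hy]⟩⟩
  obtain ⟨x, hx, hmin⟩ := exists_min_image _ f hne
  rw [mem_filter] at hx
  refine ⟨f x, hx.2, ?_⟩
  rcases {z ∈ S | f z < f x}.eq_empty_or_nonempty with h | h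
  · simpa [h] using ht₀
  · obtain ⟨w, hw, hmax⟩ := exists_max_image _ f h
    by_contra! hlt
    have hsub : {z ∈ S | f z < f x} ⊆ {z ∈ S | f z ≤ f w} := fun z hz =>
      mem_filter.2 ⟨(mem_filter.1 hz).1, hmax z hz⟩
    have hwt : t ≤ #{z ∈ S | f z ≤ f w} :=
      hlt.le.trans (by exact_mod_cast card_le_card hsub)
    rw [mem_filter] at hw
    exact (hmin w (mem_filter.2 ⟨hw.1, hwt⟩)).not_gt hw.2

open Finset in
theorem exists_upper_quantile {α : Type*} (S : Finset α) (hS : S.Nonempty) (f : α → ℝ) {t : ℝ}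
    (ht₀ : 0 ≤ t) (ht : t ≤ #S) :
    ∃ u : ℝ, t ≤ #{x ∈ S | u ≤ f x} ∧ #{x ∈ S | u < f x} ≤ t := by
  obtain ⟨l, h₁, h₂⟩ := exists_lower_quantile S hS (fun x => -f x) ht₀ ht
  exact ⟨-l, by simpa only [neg_le] using h₁, by simpa only [neg_lt] using h₂⟩

open Finset in
/-- If every choice of one point from each of the sets `A i` has all its supersets of size `|ι|`
within `S` in the family `𝒯`, then `𝒯` is large. -/
theorem card_piFinset_le_card_mul_pow {α ι : Type*} [DecidableEq α] [Fintype ι] [DecidableEq ι]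
    (S : Finset α) (hS : Fintype.card ι ≤ #S) (A : ι → Finset α) (hA : ∀ i, A i ⊆ S)
    (𝒯 : Finset (Finset α)) (hcard : ∀ T ∈ 𝒯, #T = Fintype.card ι)
    (h : ∀ f : ι → α, (∀ i, f i ∈ A i) → ∀ T ⊆ S, #T = Fintype.card ι → (∀ i, f i ∈ T) → T ∈ 𝒯) :
    #(Fintype.piFinset A) ≤ #𝒯 * Fintype.card ι ^ Fintype.card ι := by
  have hsub : Fintype.piFinset A ⊆ 𝒯.biUnion fun T => Fintype.piFinset fun _ : ι => T := by
    intro f hf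
    rw [Fintype.mem_piFinset] at hf
    obtain ⟨T, hT, hTS, hTc⟩ := exists_subsuperset_card_eq (s := univ.image f) (t := S)
      (n := Fintype.card ι) (image_subset_iff.2 fun i _ => hA i (hf i)) card_image_le hS
    have hfT : ∀ i, f i ∈ T := fun i => hT (mem_image_of_mem f (mem_univ i))
    exact mem_biUnion.2 ⟨T, h f hf T hTS hTc hfT, Fintype.mem_piFinset.2 hfT⟩
  refine (card_le_card hsub).trans (card_biUnion_le_card_mul _ _ _ fun T hT => ?_)
  simp [hcard T hT]

theorem mem_translate_Icc_iff {d : ℕ} {a b v x : Fin d → ℝ} :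
    x ∈ (fun y => v + y) '' Set.Icc a b ↔ ∀ j, v j + a j ≤ x j ∧ x j ≤ v j + b j := by
  rw [Set.image_const_add_Icc, Set.mem_Icc, Pi.le_def, Pi.le_def, ← forall_and]
  rfl

/-- Given thresholds `l` and `u` in every coordinate and side lengths `s`, the point `x` is too far
from `u` (for `α = 0`) or too far from `l` (for `α = 1`) in coordinate `a` to share a box with
points beyond that threshold. -/
def FarFrom {d : ℕ} (l u s x : Fin d → ℝ) (c : Fin d × ZMod 2) : Prop :=
  if c.2 = 0 then x c.1 < u c.1 - s c.1 else l c.1 + s c.1 < x c.1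

/-- Points satisfying an inconsistent system of parity constraints, together with points beyond the
thresholds, are not covered by two translates. -/
theorem not_covered_of_inconsistent {d : ℕ} {A A' l u : Fin d → ℝ}
    {g : Fin d → (Fin d × ZMod 2) × (Fin d × ZMod 2)}
    (hg : ∀ σ : Fin d → ZMod 2, ∃ i, σ (g i).1.1 + (g i).1.2 ≠ σ (g i).2.1 + (g i).2.2)
    {p q x : Fin d → Fin d → ℝ} (hp : ∀ j, p j j ≤ l j) (hq : ∀ j, u j ≤ q j j)
    (hlx : ∀ i, l ≤ x i) (hxu : ∀ i, x i ≤ u)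
    (hx₁ : ∀ i, FarFrom l u (A' - A) (x i) (g i).1)
    (hx₂ : ∀ i, FarFrom l u (A' - A) (x i) (g i).2)
    {T : Set (Fin d → ℝ)} (hpT : ∀ j, p j ∈ T) (hqT : ∀ j, q j ∈ T) (hxT : ∀ i, x i ∈ T) :
    ¬ ∃ v w : Fin d → ℝ, T ⊆ ((fun y => v + y) '' Set.Icc A A') ∪
      ((fun y => w + y) '' Set.Icc A A') := by
  classical
  rintro ⟨v, w, hT⟩
  set V := (fun y => v + y) '' Set.Icc A A'
  set W := (fun y => w + y) '' Set.Icc A A'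
  have apartV : ∀ {y z : Fin d → ℝ} (a : Fin d), y a + (A' a - A a) < z a →
      y ∈ V → z ∈ V → False := by
    intro y z a h hy hz
    have h₁ := (mem_translate_Icc_iff.1 hy a).1
    have h₂ := (mem_translate_Icc_iff.1 hz a).2
    linarith
  have apartW : ∀ {y z : Fin d → ℝ} (a : Fin d), y a + (A' a - A a) < z a →
      y ∈ W → z ∈ W → False := by
    intro y z a h hy hz
    have h₁ := (mem_translate_Icc_iff.1 hy a).1
    have h₂ := (mem_translate_Icc_iff.1 hz a).2
    linarith
  let ind : (Fin d → ℝ) → ZMod 2 := fun y => if y ∈ V then 1 else 0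
  have key : ∀ i c, FarFrom l u (A' - A) (x i) c → ind (x i) = ind (p c.1) + c.2 := by
    rintro i ⟨a, α⟩ h
    have hx := hT (hxT i)
    have hpa := hT (hpT a)
    have hqa := hT (hqT a)
    have h₁ := hp a
    have h₂ := hq a
    have h₃ := hlx i a
    have h₄ := hxu i a
    have hα : α = 0 ∨ α = 1 := by clear h; revert α; decide
    rw [Set.mem_union] at hx hpa hqa
    rcases hα with rfl | rfl
    · simp only [FarFrom, if_true, Pi.sub_apply] at h
      have hxq : x i a + (A' a - A a) < q a a := by linarith
      have hpq : p a a + (A' a - A a) < q a a := by linarith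
      have := apartV a hxq
      have := apartW a hxq
      have := apartV a hpq
      have := apartW a hpq
      have hiff : x i ∈ V ↔ p a ∈ V := by tauto
      simp [ind, hiff]
    · simp only [FarFrom, one_ne_zero, if_false, Pi.sub_apply] at h
      have hpx : p a a + (A' a - A a) < x i a := by linarith
      have := apartV a hpx
      have := apartW a hpx
      have hiff : x i ∈ V ↔ p a ∉ V := by tauto
      by_cases hpV : p a ∈ V
      · simp [ind, hiff, hpV, CharTwo.add_self_eq_zero]
      · simp [ind, hiff, hpV]
  obtain ⟨i, hi⟩ := hg fun a => ind (p a)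
  exact hi ((key i _ (hx₁ i)).symm.trans (key i _ (hx₂ i)))

/-- A solution `σ` of the parity constraints gives a pair of translates; every point between the
thresholds that they miss satisfies a constraint violated by `σ`. -/
theorem exists_translates_of_assignment {d : ℕ} (A A' l u : Fin d → ℝ) (σ : Fin d → ZMod 2) :
    ∃ v w : Fin d → ℝ, ∀ x : Fin d → ℝ, l ≤ x → x ≤ u →
      x ∉ ((fun y => v + y) '' Set.Icc A A') ∪ ((fun y => w + y) '' Set.Icc A A') →
      ∃ κ : (Fin d × ZMod 2) × (Fin d × ZMod 2),
        FarFrom l u (A' - A) x κ.1 ∧ FarFrom l u (A' - A) x κ.2 ∧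
        σ κ.1.1 + κ.1.2 ≠ σ κ.2.1 + κ.2.2 := by
  let corner : (Fin d → ZMod 2) → Fin d → ℝ := fun ρ a =>
    if ρ a = 1 then l a - A a else u a - A' a
  have missed : ∀ ρ : Fin d → ZMod 2, ∀ x : Fin d → ℝ, l ≤ x → x ≤ u →
      x ∉ (fun y => corner ρ + y) '' Set.Icc A A' →
      ∃ a, FarFrom l u (A' - A) x (a, ρ a) := by
    intro ρ x hl hu hx
    rw [mem_translate_Icc_iff, not_forall] at hx
    obtain ⟨a, ha⟩ := hx
    refine ⟨a, ?_⟩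
    have h₁ := hl a
    have h₂ := hu a
    have hρ : ρ a = 0 ∨ ρ a = 1 := by generalize ρ a = r; revert r; decide
    rcases hρ with h | h
    · simp only [corner, h, zero_ne_one, if_false] at ha
      simp only [FarFrom, if_true, Pi.sub_apply, h]
      by_contra! hc
      exact ha ⟨by linarith, by linarith⟩
    · simp only [corner, h, if_true] at ha
      simp only [FarFrom, one_ne_zero, if_false, Pi.sub_apply, h]
      by_contra! hc
      exact ha ⟨by linarith, by linarith⟩
  refine ⟨corner σ, corner fun j => σ j + 1, fun x hl hu hx => ?_⟩
  rw [Set.mem_union, not_or] at hx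
  obtain ⟨a, ha⟩ := missed σ x hl hu hx.1
  obtain ⟨b, hb⟩ := missed (fun j => σ j + 1) x hl hu hx.2
  refine ⟨((a, σ a), (b, σ b + 1)), ha, hb, ?_⟩
  dsimp only
  generalize σ a = r
  generalize σ b = t
  revert r t
  decide

open Finset in
/-- A point set from which two translates of a box always miss an `ε` fraction contains `3d` large
subsets such that every transversal of them is not covered by two translates. -/
theorem exists_uncoverable_transversals {d : ℕ} (hd : 1 ≤ d) {ε : ℝ} (hε : ε ∈ Set.Ioc (0 : ℝ) 1)
    (A A' : Fin d → ℝ) (S : Finset (Fin d → ℝ)) (hS : S.Nonempty)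
    (hmiss : ∀ v w : Fin d → ℝ,
        ε * (S.card : ℝ) ≤
          (({x ∈ (↑S : Set (Fin d → ℝ)) |
              x ∉ ((fun y => v + y) '' Set.Icc A A') ∪
                ((fun y => w + y) '' Set.Icc A A')}).ncard : ℝ)) :
    ∃ P : Fin d ⊕ Fin d ⊕ Fin d → Finset (Fin d → ℝ),
      (∀ i, P i ⊆ S) ∧ (∀ i, ε / (8 * d ^ 2) * #S ≤ #(P i)) ∧
      ∀ f : Fin d ⊕ Fin d ⊕ Fin d → Fin d → ℝ, (∀ i, f i ∈ P i) →
        ∀ T : Set (Fin d → ℝ), (∀ i, f i ∈ T) →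
        ¬ ∃ v w : Fin d → ℝ, T ⊆ ((fun y => v + y) '' Set.Icc A A') ∪
          ((fun y => w + y) '' Set.Icc A A') := by
  classical
  obtain ⟨hε₀, hε₁⟩ := hε
  have hd' : (1 : ℝ) ≤ d := by exact_mod_cast hd
  have hm : (0 : ℝ) < #S := by exact_mod_cast hS.card_pos
  set t : ℝ := ε / (8 * d ^ 2) * #S with ht
  have ht₀ : 0 < t := by positivity
  have ht₁ : t ≤ #S := by
    have : ε / (8 * d ^ 2) ≤ 1 := by
      rw [div_le_one (by positivity)]
      nlinarith
    nlinarith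
  choose l hl hl' using fun j : Fin d => exists_lower_quantile S hS (fun x => x j) ht₀.le ht₁
  choose u hu hu' using fun j : Fin d => exists_upper_quantile S hS (fun x => x j) ht₀.le ht₁
  let X : (Fin d × ZMod 2) × (Fin d × ZMod 2) → Finset (Fin d → ℝ) := fun κ =>
    {x ∈ S | l ≤ x ∧ x ≤ u ∧ FarFrom l u (A' - A) x κ.1 ∧ FarFrom l u (A' - A) x κ.2}
  have hH : ∀ σ : Fin d → ZMod 2, ∃ κ ∈ {κ | t ≤ #(X κ)},
      σ κ.1.1 + κ.1.2 ≠ σ κ.2.1 + κ.2.2 := by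
    intro σ
    by_contra! hcon
    obtain ⟨v, w, hvw⟩ := exists_translates_of_assignment A A' l u σ
    have hsub : {x ∈ (↑S : Set (Fin d → ℝ)) | x ∉ ((fun y => v + y) '' Set.Icc A A') ∪
        ((fun y => w + y) '' Set.Icc A A')} ⊆
        ↑((univ.biUnion fun j => {x ∈ S | x j < l j}) ∪
          (univ.biUnion fun j => {x ∈ S | u j < x j}) ∪
          ({κ | ¬ t ≤ #(X κ)} : Finset _).biUnion X) := by
      rintro x ⟨hxS, hx⟩
      rw [mem_coe] at hxS
      rw [mem_coe, mem_union, mem_union]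
      by_cases h₁ : l ≤ x
      · by_cases h₂ : x ≤ u
        · obtain ⟨κ, hκ₁, hκ₂, hκ⟩ := hvw x h₁ h₂ hx
          refine Or.inr (mem_biUnion.2 ⟨κ, mem_filter.2 ⟨mem_univ _, fun h => hκ (hcon κ h)⟩, ?_⟩)
          exact mem_filter.2 ⟨hxS, h₁, h₂, hκ₁, hκ₂⟩
        · simp only [Pi.le_def, not_forall, not_le] at h₂
          obtain ⟨j, hj⟩ := h₂
          exact Or.inl (Or.inr (mem_biUnion.2 ⟨j, mem_univ _, mem_filter.2 ⟨hxS, hj⟩⟩))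
      · simp only [Pi.le_def, not_forall, not_le] at h₁
        obtain ⟨j, hj⟩ := h₁
        exact Or.inl (Or.inl (mem_biUnion.2 ⟨j, mem_univ _, mem_filter.2 ⟨hxS, hj⟩⟩))
    have hcard := Set.ncard_le_ncard hsub (finite_toSet _)
    rw [Set.ncard_coe_finset] at hcard
    have bound : ∀ {ι : Type} (I : Finset ι) (F : ι → Finset (Fin d → ℝ)),
        (∀ i ∈ I, (#(F i) : ℝ) ≤ t) → (#(I.biUnion F) : ℝ) ≤ #I * t := by
      intro ι I F hF
      calc (#(I.biUnion F) : ℝ) ≤ ∑ i ∈ I, (#(F i) : ℝ) := by exact_mod_cast card_biUnion_le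
        _ ≤ #I * t := by simpa using sum_le_card_nsmul I _ t hF
    have b₁ := bound univ (fun j => {x ∈ S | x j < l j}) fun j _ => hl' j
    have b₂ := bound univ (fun j => {x ∈ S | u j < x j}) fun j _ => hu' j
    have b₃ := bound {κ | ¬ t ≤ #(X κ)} X fun κ hκ => (not_le.1 (mem_filter.1 hκ).2).le
    have b₄ : (#{κ | ¬ t ≤ #(X κ)} : ℝ) ≤ (d * 2) * (d * 2) := by
      have h := card_le_univ ({κ | ¬ t ≤ #(X κ)} : Finset _)
      simp only [Fintype.card_prod, Fintype.card_fin, ZMod.card] at h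
      exact_mod_cast h
    have b₅ : (#{κ | ¬ t ≤ #(X κ)} : ℝ) * t ≤ (d * 2) * (d * 2) * t := by gcongr
    rw [card_univ, Fintype.card_fin] at b₁ b₂
    have hsum : ε * #S ≤ d * t + d * t + (d * 2) * (d * 2) * t := by
      refine (hmiss v w).trans ((Nat.cast_le.2 hcard).trans ?_)
      refine (Nat.cast_le.2 (card_union_le _ _)).trans ?_
      rw [Nat.cast_add]
      have b₀ := (Nat.cast_le (α := ℝ)).2 (card_union_le
        (univ.biUnion fun j => {x ∈ S | x j < l j}) (univ.biUnion fun j => {x ∈ S | u j < x j}))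
      rw [Nat.cast_add] at b₀
      linarith
    have heq : ε * #S = 8 * d ^ 2 * t := by
      rw [ht]
      field_simp
    rw [heq] at hsum
    nlinarith [mul_pos (mul_pos (by linarith : (0 : ℝ) < d) (by linarith : (0 : ℝ) < d)) ht₀,
      mul_nonneg (mul_nonneg (by linarith : (0 : ℝ) ≤ d) (sub_nonneg.2 hd')) ht₀.le]
  obtain ⟨g, hgH, hg⟩ := exists_inconsistent_parity_subsystem hd _ hH
  refine ⟨Sum.elim (fun j => {x ∈ S | x j ≤ l j})
    (Sum.elim (fun j => {x ∈ S | u j ≤ x j}) fun i => X (g i)), ?_, ?_, ?_⟩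
  · rintro (i | i | i) <;> exact filter_subset _ _
  · rintro (i | i | i)
    exacts [hl i, hu i, hgH i]
  · intro f hf T hT
    have hx : ∀ i, f (.inr (.inr i)) ∈ X (g i) := fun i => hf (.inr (.inr i))
    simp only [X, mem_filter] at hx
    exact not_covered_of_inconsistent hg
      (p := fun j => f (.inl j)) (q := fun j => f (.inr (.inl j))) (x := fun i => f (.inr (.inr i)))
      (fun j => (mem_filter.1 (hf (.inl j))).2) (fun j => (mem_filter.1 (hf (.inr (.inl j)))).2)
      (fun i => (hx i).2.1) (fun i => (hx i).2.2.1) (fun i => (hx i).2.2.2.1)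
      (fun i => (hx i).2.2.2.2) (fun j => hT _) (fun j => hT _) (fun i => hT _)

/-- If no two translated copies of an axis-parallel box `B` cover more than a
`(1 - ε)` fraction of a finite point set `S` (with `|S| ≥ 3d`), then at least a `γ`
fraction of all `3d`-element subsets of `S` cannot be covered by any two translated
copies of `B`, where `γ` depends only on `ε` and `d`. -/
theorem fraction_of_uncoverable_subsets (d : ℕ) (hd : 1 ≤ d)
    (ε : ℝ) (hε : ε ∈ Set.Ioc (0 : ℝ) 1) :
    ∃ γ : ℝ, γ ∈ Set.Ioc (0 : ℝ) 1 ∧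
      ∀ B : Set (Fin d → ℝ), IsBox B →
      ∀ S : Finset (Fin d → ℝ), 3 * d ≤ S.card →
      (∀ v w : Fin d → ℝ,
        ε * (S.card : ℝ) ≤
          (({x ∈ (↑S : Set (Fin d → ℝ)) |
              x ∉ ((fun y => v + y) '' B) ∪ ((fun y => w + y) '' B)}).ncard : ℝ)) →
      γ * ((S.card.choose (3 * d)) : ℝ) ≤
        ({T : Finset (Fin d → ℝ) | T ⊆ S ∧ T.card = 3 * d ∧
          ¬ ∃ v w : Fin d → ℝ,
            (↑T : Set (Fin d → ℝ)) ⊆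
              ((fun y => v + y) '' B) ∪ ((fun y => w + y) '' B)}.ncard : ℝ) := by
  classical
  have hd' : (1 : ℝ) ≤ d := by exact_mod_cast hd
  have hδ : ε / (8 * d ^ 2) ≤ 1 := by
    rw [div_le_one (by positivity)]
    nlinarith [hε.2]
  have hδ₀ : 0 < ε / (8 * d ^ 2) := div_pos hε.1 (by positivity)
  refine ⟨(ε / (8 * d ^ 2) / (3 * d)) ^ (3 * d), ⟨by positivity, ?_⟩, ?_⟩
  · refine pow_le_one₀ (by positivity) ?_
    rw [div_le_one (by positivity)]
    linarith
  rintro _ ⟨A, A', -, rfl⟩ S hS hmiss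
  have hne : S.Nonempty := Finset.card_pos.1 (by omega)
  obtain ⟨P, hPS, hPc, hP⟩ := exists_uncoverable_transversals hd hε A A' S hne hmiss
  have hι : Fintype.card (Fin d ⊕ Fin d ⊕ Fin d) = 3 * d := by
    simp only [Fintype.card_sum, Fintype.card_fin]
    ring
  set 𝒯 : Finset (Finset (Fin d → ℝ)) := {T ∈ S.powersetCard (3 * d) |
    ¬ ∃ v w : Fin d → ℝ, (↑T : Set (Fin d → ℝ)) ⊆ ((fun y => v + y) '' Set.Icc A A') ∪
      ((fun y => w + y) '' Set.Icc A A')} with h𝒯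
  have hset : {T : Finset (Fin d → ℝ) | T ⊆ S ∧ T.card = 3 * d ∧
      ¬ ∃ v w : Fin d → ℝ, (↑T : Set (Fin d → ℝ)) ⊆ ((fun y => v + y) '' Set.Icc A A') ∪
        ((fun y => w + y) '' Set.Icc A A')} = ↑𝒯 := by
    ext T
    rw [h𝒯, Finset.mem_coe, Finset.mem_filter, Finset.mem_powersetCard, and_assoc]
    rfl
  rw [hset, Set.ncard_coe_finset]
  have hcount := card_piFinset_le_card_mul_pow S (hι.trans_le hS) P hPS 𝒯
    (fun T hT => hι.symm ▸ (Finset.mem_powersetCard.1 (Finset.mem_filter.1 hT).1).2)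
    (fun f hf T hTS hTc hfT => Finset.mem_filter.2
      ⟨Finset.mem_powersetCard.2 ⟨hTS, hTc.trans hι⟩, hP f hf ↑T hfT⟩)
  rw [hι, Fintype.card_piFinset] at hcount
  have hprod : (ε / (8 * d ^ 2) * S.card) ^ (3 * d) ≤ (𝒯.card : ℝ) * (3 * d) ^ (3 * d) := by
    calc (ε / (8 * d ^ 2) * S.card) ^ (3 * d)
        = ∏ _i : Fin d ⊕ Fin d ⊕ Fin d, (ε / (8 * d ^ 2) * S.card) := by
          rw [Finset.prod_const, Finset.card_univ, hι]
      _ ≤ ∏ i, ((P i).card : ℝ) := Finset.prod_le_prod (fun _ _ => by positivity) fun i _ => hPc i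
      _ ≤ _ := by exact_mod_cast hcount
  have hchoose : (S.card.choose (3 * d) : ℝ) ≤ (S.card : ℝ) ^ (3 * d) := by
    exact_mod_cast Nat.choose_le_pow _ _
  calc (ε / (8 * d ^ 2) / (3 * d)) ^ (3 * d) * (S.card.choose (3 * d) : ℝ)
      ≤ (ε / (8 * d ^ 2) / (3 * d)) ^ (3 * d) * (S.card : ℝ) ^ (3 * d) := by gcongr
    _ = (ε / (8 * d ^ 2) * S.card) ^ (3 * d) / (3 * d) ^ (3 * d) := by
        rw [div_pow, mul_pow]
        ring
    _ ≤ 𝒯.card := by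
        rw [div_le_iff₀ (by positivity)]
        exact hprod
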